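/- arXiv:1910.10132 — 2 statements merged into one kernel-verified Lean document; each statement's English description precedes it below -/
import Mathlib

section
/- Let n ≥ 3 be an integer and let q be a real number with 0 < q ≤ 1/6. Define the row-stochastic matrix P(q) : Fin n → Fin n → ℝ by: P 0 0 = 1-q, P 0 1 = q; P 1 0 = 5q, P 1 1 = 1-6q, P 1 2 = q; for 2 ≤ i ≤ n-2, P i 0 = 4q, P i (i-1) = q, P i i = 1-6q, P i (i+1) = q; P (n-1) 0 = 5q, P (n-1) (n-2) = q, P (n-1) (n-1) = 1-6q; and P i j = 0 otherwise. Then the vector π : Fin n → ℝ defined by π i = 2*B(n-i) / b(n+1) (with the numbers cast to ℝ) is a steady-state vector of P(q), i.e., π j = ∑ i, π i * P(q) i j for every j, and ∑ i, π i = 1. -/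
/-- Four times the sum of the first `m + 1` nonzero balancing numbers. -/
theorem four_mul_sum_balancing (B : ℕ → ℤ) (hB0 : B 0 = 0) (hB1 : B 1 = 1)
    (hBrec : ∀ k, B (k + 2) = 6 * B (k + 1) - B k) (m : ℕ) :
    4 * ∑ k ∈ Finset.range (m + 1), B (k + 1) = 5 * B (m + 1) - B m - 1 := by
  induction m with
  | zero => simp [hB0, hB1]
  | succ m ih =>
    rw [Finset.sum_range_succ, mul_add, ih, hBrec m]
    ring

theorem two_mul_cobalancing (B : ℕ → ℤ) (hB0 : B 0 = 0) (hB1 : B 1 = 1)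
    (hBrec : ∀ k, B (k + 2) = 6 * B (k + 1) - B k)
    (b : ℕ → ℤ) (hb0 : b 0 = 0) (hb1 : b 1 = 0)
    (hbrec : ∀ k, b (k + 2) = 6 * b (k + 1) - b k + 2) (m : ℕ) :
    2 * b (m + 1 + 1) = 5 * B (m + 1) - B m - 1 := by
  induction m using Nat.twoStepInduction with
  | zero => simp [hB0, hB1, hbrec, hb0, hb1]
  | one => simp [hB0, hB1, hBrec, hbrec, hb0, hb1]
  | more m ih₁ ih₂ => linarith [hbrec (m + 2), hBrec m, hBrec (m + 1)]

theorem cobalancing_pos (b : ℕ → ℤ) (hb0 : b 0 = 0) (hb1 : b 1 = 0)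
    (hbrec : ∀ k, b (k + 2) = 6 * b (k + 1) - b k + 2) (m : ℕ) :
    0 < b (m + 2) := by
  have h : ∀ k, 0 ≤ b k ∧ b k ≤ b (k + 1) := by
    intro k
    induction k with
    | zero => simp [hb0, hb1]
    | succ k ih => have := hbrec k; constructor <;> linarith
  linarith [hbrec m, h m, (h m).1, (h m).2]


/-- Balancing numbers in the steady state probabilities of the class of Markov chains (4). -/
theorem balancing_steady_state_class
    (n : ℕ) (hn : 3 ≤ n)
    (q : ℝ) (hq0 : 0 < q) (hq1 : q ≤ 1/6)
    (B : ℕ → ℤ) (hB0 : B 0 = 0) (hB1 : B 1 = 1)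
    (hBrec : ∀ k, B (k + 2) = 6 * B (k + 1) - B k)
    (b : ℕ → ℤ) (hb0 : b 0 = 0) (hb1 : b 1 = 0)
    (hbrec : ∀ k, b (k + 2) = 6 * b (k + 1) - b k + 2)
    (P : Fin n → Fin n → ℝ)
    (hP : ∀ i j : Fin n, P i j =
      if i.val = 0 ∧ j.val = 0 then 1 - q
      else if i.val = 0 ∧ j.val = 1 then q
      else if i.val = 1 ∧ j.val = 0 then 5 * q
      else if i.val = 1 ∧ j.val = 1 then 1 - 6 * q
      else if i.val = 1 ∧ j.val = 2 then q
      else if 2 ≤ i.val ∧ i.val ≤ n - 2 ∧ j.val = 0 then 4 * q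
      else if 2 ≤ i.val ∧ i.val ≤ n - 2 ∧ j.val = i.val - 1 then q
      else if 2 ≤ i.val ∧ i.val ≤ n - 2 ∧ j.val = i.val then 1 - 6 * q
      else if 2 ≤ i.val ∧ i.val ≤ n - 2 ∧ j.val = i.val + 1 then q
      else if i.val = n - 1 ∧ j.val = 0 then 5 * q
      else if i.val = n - 1 ∧ j.val = n - 2 then q
      else if i.val = n - 1 ∧ j.val = n - 1 then 1 - 6 * q
      else 0)
    (π : Fin n → ℝ)
    (hπ : ∀ i : Fin n, π i = 2 * (B (n - i.val) : ℝ) / (b (n + 1) : ℝ)) :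
    (∀ j : Fin n, π j = ∑ i, π i * P i j) ∧ (∑ i, π i) = 1 := by
  obtain ⟨m, rfl⟩ : ∃ m, n = m + 1 := ⟨n - 1, by omega⟩
  have hb : (0 : ℝ) < b (m + 1 + 1) := by exact_mod_cast cobalancing_pos b hb0 hb1 hbrec m
  have hcob : (2 : ℝ) * b (m + 1 + 1) = 5 * B (m + 1) - B m - 1 := by
    exact_mod_cast two_mul_cobalancing B hB0 hB1 hBrec b hb0 hb1 hbrec m
  have hsumB : ∑ i : Fin (m + 1), (B (m + 1 - i.val) : ℝ) = b (m + 1 + 1) / 2 := by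
    rw [Fin.sum_univ_eq_sum_range (fun i => (B (m + 1 - i) : ℝ)),
      ← Finset.sum_range_reflect]
    have h : (4 : ℝ) * ∑ k ∈ Finset.range (m + 1), (B (k + 1) : ℝ) = 5 * B (m + 1) - B m - 1 := by
      exact_mod_cast four_mul_sum_balancing B hB0 hB1 hBrec m
    rw [Finset.sum_congr rfl (g := fun k => (B (k + 1) : ℝ))]
    · linarith
    · intro k hk
      rw [Finset.mem_range] at hk
      congr 2
      omega
  have hsumπ : ∑ i, π i = 1 := by
    simp_rw [hπ]
    rw [← Finset.sum_div, ← Finset.mul_sum, hsumB]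
    field_simp
  refine ⟨fun j => ?_, hsumπ⟩
  have hP' : ∀ i, P i j = (if j.val = i.val + 1 then q else 0) + (if i.val = j.val + 1 then q else 0)
      + (if i = j then 1 - 6 * q else 0)
      + if j.val = 0 then
          4 * q + (if i = 0 then q else 0) + (if i = Fin.last m then q else 0) else 0 := by
    intro i
    have hi := i.isLt
    have hj := j.isLt
    rw [hP]
    simp only [Fin.ext_iff, Fin.val_last, Fin.val_zero]
    clear * - hn hi hj
    grind (splits := 30)
  have hsucc : ∑ i, π i * (if i.val = j.val + 1 then q else 0)
      = 2 * (B (m - j.val) : ℝ) / b (m + 1 + 1) * q := by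
    by_cases hj : j.val = m
    · rw [Finset.sum_eq_zero]
      · simp [hj, hB0]
      · intro i _
        rw [if_neg (by omega), mul_zero]
    · rw [Finset.sum_eq_single ⟨j.val + 1, by omega⟩]
      · simp [hπ]
      · intro i _ hi
        rw [if_neg (fun h => hi (Fin.ext h)), mul_zero]
      · simp
  simp only [hP', mul_add, Finset.sum_add_distrib, hsucc]
  by_cases hj : j.val = 0
  · obtain rfl : j = 0 := Fin.ext hj
    simp [mul_add, Finset.sum_add_distrib, ← Finset.sum_mul, hsumπ]
    simp only [hπ, Fin.val_zero, Fin.val_last, Nat.sub_zero, Nat.add_sub_cancel_left, hB1]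
    field_simp
    push_cast
    linear_combination -2 * q * hcob
  · have hpred : ∑ i, π i * (if j.val = i.val + 1 then q else 0)
        = 2 * (B (m - j.val + 2) : ℝ) / b (m + 1 + 1) * q := by
      rw [Finset.sum_eq_single ⟨j.val - 1, by omega⟩]
      · rw [if_pos (by simp only; omega), hπ]
        congr 6
        simp only
        omega
      · intro i _ hi
        rw [if_neg (fun h => hi (Fin.ext (by simp only; omega))), mul_zero]
      · simp
    have hidx : m + 1 - j.val = m - j.val + 1 := by omega
    rw [hpred]
    simp only [hj, mul_ite, mul_zero, Finset.sum_ite_eq', Finset.mem_univ, if_true, if_false,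
      Finset.sum_const_zero, hπ, hidx, hBrec]
    push_cast
    ring
end

section
/- Let A ≥ 3 be an integer and let x : ℕ → ℤ be the balancing-like sequence given by x 0 = 0, x 1 = 1, x (k+2) = A*x (k+1) - x k. Let n ≥ 3 be an integer. Define the row-stochastic matrix P : Fin n → Fin n → ℝ by: P 0 0 = 1 - 1/A, P 0 1 = 1/A; P 1 0 = 1 - 1/A, P 1 2 = 1/A; for 2 ≤ i ≤ n-2, P i 0 = 1 - 2/A, P i (i-1) = 1/A, P i (i+1) = 1/A; P (n-1) 0 = 1 - 1/A, P (n-1) (n-2) = 1/A; and P i j = 0 otherwise. Then the vector π : Fin n → ℝ defined by π i = x(n-i) / (∑_{l=1}^{n} x(l)) (with the numbers cast to ℝ) is a steady-state vector of P, i.e., π j = ∑ i, π i * P i j for every j, and ∑ i, π i = 1. -/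
/-- A sequence with `x 0 = 0`, `x 1 = 1` and `x (k + 2) = A * x (k + 1) - x k`, where `2 ≤ A`,
is nonnegative and strictly increasing. -/
theorem balancing_like_nonneg_and_lt_succ {A : ℤ} (hA : 2 ≤ A) {x : ℕ → ℤ}
    (hx0 : x 0 = 0) (hx1 : x 1 = 1) (hxrec : ∀ k, x (k + 2) = A * x (k + 1) - x k) (k : ℕ) :
    0 ≤ x k ∧ x k < x (k + 1) := by
  induction k with
  | zero => simp [hx0, hx1]
  | succ k ih =>
    obtain ⟨h0, h1⟩ := ih
    refine ⟨by linarith, ?_⟩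
    rw [hxrec k]
    nlinarith [mul_nonneg (sub_nonneg.2 hA) (h0.trans h1.le)]

/-- Reversing the order of summation over `{1, …, n}`. -/
theorem sum_range_sub_eq_sum_Icc {M : Type*} [AddCommMonoid M] (f : ℕ → M) (n : ℕ) :
    ∑ i ∈ Finset.range n, f (n - i) = ∑ l ∈ Finset.Icc 1 n, f l := by
  refine Finset.sum_nbij' (fun i => n - i) (fun l => n - l) ?_ ?_ ?_ ?_ ?_ <;>
    simp only [Finset.mem_range, Finset.mem_Icc, implies_true] <;> intros <;> omega

/-- If a vector is balanced at every state but one of a matrix whose rows sum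
to one, then it is balanced at the remaining state as well. -/
theorem balance_of_forall_ne {ι : Type*} [Fintype ι] [DecidableEq ι] {P : ι → ι → ℝ}
    {π : ι → ℝ} (hP : ∀ i, ∑ j, P i j = 1) {a : ι} (h : ∀ j ≠ a, π j = ∑ i, π i * P i j) :
    π a = ∑ i, π i * P i a := by
  have htotal : ∑ j, ∑ i, π i * P i j = ∑ j, π j := by
    rw [Finset.sum_comm]
    simp only [← Finset.mul_sum, hP, mul_one]
  rw [← Finset.add_sum_erase _ _ (Finset.mem_univ a),
    ← Finset.add_sum_erase _ π (Finset.mem_univ a),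
    Finset.sum_congr rfl fun j hj => (h j (Finset.ne_of_mem_erase hj)).symm] at htotal
  linarith

/-- Balancing-like numbers in the steady state probabilities of the Markov chain (14). -/
theorem balancing_like_steady_state
    (A : ℤ) (hA : 3 ≤ A)
    (x : ℕ → ℤ) (hx0 : x 0 = 0) (hx1 : x 1 = 1)
    (hxrec : ∀ k, x (k + 2) = A * x (k + 1) - x k)
    (n : ℕ) (hn : 3 ≤ n)
    (P : Fin n → Fin n → ℝ)
    (hP : ∀ i j : Fin n, P i j =
      if i.val = 0 ∧ j.val = 0 then 1 - 1 / (A : ℝ)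
      else if i.val = 0 ∧ j.val = 1 then 1 / (A : ℝ)
      else if i.val = 1 ∧ j.val = 0 then 1 - 1 / (A : ℝ)
      else if i.val = 1 ∧ j.val = 2 then 1 / (A : ℝ)
      else if 2 ≤ i.val ∧ i.val ≤ n - 2 ∧ j.val = 0 then 1 - 2 / (A : ℝ)
      else if 2 ≤ i.val ∧ i.val ≤ n - 2 ∧ j.val = i.val - 1 then 1 / (A : ℝ)
      else if 2 ≤ i.val ∧ i.val ≤ n - 2 ∧ j.val = i.val + 1 then 1 / (A : ℝ)
      else if i.val = n - 1 ∧ j.val = 0 then 1 - 1 / (A : ℝ)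
      else if i.val = n - 1 ∧ j.val = n - 2 then 1 / (A : ℝ)
      else 0)
    (π : Fin n → ℝ)
    (hπ : ∀ i : Fin n, π i = (x (n - i.val) : ℝ) / ((∑ l ∈ Finset.Icc 1 n, x l : ℤ) : ℝ)) :
    (∀ j : Fin n, π j = ∑ i, π i * P i j) ∧ (∑ i, π i) = 1 := by
  have hA0 : (A : ℝ) ≠ 0 := by
    have : A ≠ 0 := by omega
    exact_mod_cast this
  have hmono := balancing_like_nonneg_and_lt_succ (by omega) hx0 hx1 hxrec
  set S : ℤ := ∑ l ∈ Finset.Icc 1 n, x l with hS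
  have hSpos : 0 < S := by
    have h1 : x 1 ≤ S :=
      Finset.single_le_sum (fun l _ => (hmono l).1) (Finset.mem_Icc.2 ⟨le_rfl, by omega⟩)
    omega
  have hS0 : (S : ℝ) ≠ 0 := by exact_mod_cast hSpos.ne'
  have hPform : ∀ i j : Fin n, P i j =
      (if j.val = i.val + 1 then 1 / (A : ℝ) else 0) +
      (if j.val = i.val - 1 then if 2 ≤ i.val then 1 / (A : ℝ) else 0 else 0) +
      (if j.val = 0 then 1 - (if i.val + 1 < n then 1 / (A : ℝ) else 0) -
        (if 2 ≤ i.val then 1 / (A : ℝ) else 0) else 0) := by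
    intro i j
    have hi := i.isLt
    have hj := j.isLt
    rw [hP]
    have hi4 : i.val = 0 ∨ i.val = 1 ∨ (2 ≤ i.val ∧ i.val ≤ n - 2) ∨
        (2 ≤ i.val ∧ i.val = n - 1) := by omega
    have hj4 : j.val = 0 ∨ (j.val ≠ 0 ∧ j.val = i.val + 1) ∨
        (j.val ≠ 0 ∧ j.val = i.val - 1) ∨
        (j.val ≠ 0 ∧ j.val ≠ i.val + 1 ∧ j.val ≠ i.val - 1) := by omega
    rcases hi4 with h | h | h | h <;> rcases hj4 with h' | h' | h' | h' <;>
      first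
      | omega
      | (simp (disch := omega) only [if_pos, if_neg]; ring)
  have hrow : ∀ i : Fin n, ∑ j, P i j = 1 := by
    intro i
    have hi : i.val - 1 < n := by omega
    have hn0 : 0 < n := by omega
    simp only [hPform, Finset.sum_add_distrib]
    rw [Fin.sum_univ_eq_sum_range (fun j => if j = i.val + 1 then 1 / (A : ℝ) else 0),
      Fin.sum_univ_eq_sum_range
        (fun j => if j = i.val - 1 then if 2 ≤ i.val then 1 / (A : ℝ) else 0 else 0),
      Fin.sum_univ_eq_sum_range
        (fun j => if j = 0 then 1 - (if i.val + 1 < n then 1 / (A : ℝ) else 0) -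
          (if 2 ≤ i.val then 1 / (A : ℝ) else 0) else 0)]
    simp only [Finset.sum_ite_eq', Finset.mem_range, hi, hn0, if_true]
    ring
  have hbalance : ∀ j : Fin n, j.val ≠ 0 → π j = ∑ i, π i * P i j := by
    intro j hj
    obtain ⟨m, hm⟩ := Nat.exists_eq_add_one_of_ne_zero hj
    have hmn : m + 1 < n := by omega
    have hterm : ∀ i : Fin n, π i * P i j =
        (if i.val = m then (x (n - i.val) : ℝ) / S / A else 0) +
        (if i.val = m + 2 then (x (n - i.val) : ℝ) / S / A else 0) := by
      intro i
      rw [hPform, hπ]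
      split_ifs <;> first | omega | ring
    simp only [hterm, Finset.sum_add_distrib]
    rw [Fin.sum_univ_eq_sum_range (fun i => if i = m then (x (n - i) : ℝ) / S / A else 0),
      Fin.sum_univ_eq_sum_range (fun i => if i = m + 2 then (x (n - i) : ℝ) / S / A else 0)]
    simp only [Finset.sum_ite_eq', Finset.mem_range]
    rw [if_pos (by omega), hπ, hm]
    obtain ⟨k, rfl⟩ : ∃ k, n = k + m + 2 := ⟨n - m - 2, by omega⟩
    have hlast : (if m + 2 < k + m + 2 then (x (k + m + 2 - (m + 2)) : ℝ) / S / A else 0) =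
        (x k : ℝ) / S / A := by
      split_ifs with h
      · rw [show k + m + 2 - (m + 2) = k by omega]
      · rw [show k = 0 by omega, hx0]
        simp
    rw [hlast, show k + m + 2 - (m + 1) = k + 1 by omega, show k + m + 2 - m = k + 2 by omega,
      hxrec]
    push_cast
    field_simp
    ring
  have hsum : ∑ i, π i = 1 := by
    simp only [hπ]
    rw [Fin.sum_univ_eq_sum_range (fun i => (x (n - i) : ℝ) / S), ← Finset.sum_div,
      div_eq_one_iff_eq hS0, hS, ← sum_range_sub_eq_sum_Icc]
    push_cast
    rfl
  refine ⟨fun j => ?_, hsum⟩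
  by_cases hj : j.val = 0
  · exact balance_of_forall_ne hrow fun i hi =>
      hbalance i fun h => hi (Fin.ext (h.trans hj.symm))
  · exact hbalance j hj
end
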